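/- arXiv:0909.1156 — 2 statements merged into one kernel-verified Lean document; each statement's English description precedes it below -/
import Mathlib

section
/- For every β ∈ F_q, the number of matrices w ∈ SO(3,q) with Tr(w) = β equals q² - q + q·δ(1,q;β-1), where Tr denotes the matrix trace. -/
open Finset Matrix

/-- The matrix J defining the orthogonal group O(3,q). -/
def matJ (F : Type) [Field F] : Matrix (Fin 3) (Fin 3) F := !![0,1,0; 1,0,0; 0,0,1]

/-- `δ(1,q;β) = |{x ∈ F_q : x² - βx + 1 = 0}|`. -/
def delta1 (F : Type) [Field F] [Fintype F] [DecidableEq F] (β : F) : ℕ :=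
  (Finset.univ.filter (fun x : F => x ^ 2 - β * x + 1 = 0)).card

lemma matJ_mul_self (F : Type) [Field F] : matJ F * matJ F = 1 := by
  ext i j
  fin_cases i <;> fin_cases j <;> simp [matJ, Matrix.mul_apply, Fin.sum_univ_three]

lemma matJ_mul_transpose_mul_matJ_eq_adjugate {F : Type} [Field F] {w : Matrix (Fin 3) (Fin 3) F}
    (h : wᵀ * matJ F * w = matJ F) (hd : w.det = 1) : matJ F * wᵀ * matJ F = w.adjugate := by
  have h1 : (matJ F * wᵀ * matJ F) * w = 1 := by
    rw [← matJ_mul_self F, Matrix.mul_assoc, Matrix.mul_assoc, ← Matrix.mul_assoc wᵀ, h]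
  calc matJ F * wᵀ * matJ F = (matJ F * wᵀ * matJ F) * (w * w.adjugate) := by
        rw [Matrix.mul_adjugate, hd, one_smul, Matrix.mul_one]
    _ = w.adjugate := by rw [← Matrix.mul_assoc, h1, Matrix.one_mul]

lemma mul_matJ_mul_transpose {F : Type} [Field F] {w : Matrix (Fin 3) (Fin 3) F}
    (h : wᵀ * matJ F * w = matJ F) : w * matJ F * wᵀ = matJ F := by
  have h1 : (matJ F * wᵀ * matJ F) * w = 1 := by
    rw [← matJ_mul_self F, Matrix.mul_assoc, Matrix.mul_assoc, ← Matrix.mul_assoc wᵀ, h]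
  have h2 := mul_eq_one_comm.mp h1
  calc w * matJ F * wᵀ = w * (matJ F * wᵀ * matJ F) * matJ F := by
        simp only [Matrix.mul_assoc, matJ_mul_self, Matrix.mul_one]
    _ = matJ F := by rw [h2, Matrix.one_mul]

/-- The elements of `SO(3,q)` with nonzero top-left entry `p`, in characteristic three. -/
def bigCell {F : Type} [Field F] (p x r : F) : Matrix (Fin 3) (Fin 3) F :=
  !![p, p * x ^ 2, -(x * p);
     r ^ 2 / p, (1 + x * r) ^ 2 / p, -(r + x * r ^ 2) / p;
     r, x + x ^ 2 * r, 1 - x * r]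

/-- The elements of `SO(3,q)` with zero top-left entry, in characteristic three. -/
def smallCell {F : Type} [Field F] (p k : F) : Matrix (Fin 3) (Fin 3) F :=
  !![0, 1 / p, 0; p, k ^ 2 / p, k; 0, k / p, -1]

section CharThree

variable {F : Type} [Field F] [CharP F 3]

lemma three_eq_zero_of_charP : (3 : F) = 0 := by
  exact_mod_cast CharP.cast_eq_zero F 3

lemma bigCell_mem {p : F} (hp : p ≠ 0) (x r : F) :
    (bigCell p x r)ᵀ * matJ F * bigCell p x r = matJ F ∧ (bigCell p x r).det = 1 := by
  have h3 : (3 : F) = 0 := three_eq_zero_of_charP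
  constructor
  · ext i j
    fin_cases i <;> fin_cases j <;>
      simp [matJ, bigCell, Matrix.mul_apply, Fin.sum_univ_three] <;> field_simp <;> grind
  · simp [bigCell, Matrix.det_fin_three]
    field_simp
    grind

lemma smallCell_mem {p : F} (hp : p ≠ 0) (k : F) :
    (smallCell p k)ᵀ * matJ F * smallCell p k = matJ F ∧ (smallCell p k).det = 1 := by
  have h3 : (3 : F) = 0 := three_eq_zero_of_charP
  constructor
  · ext i j
    fin_cases i <;> fin_cases j <;>
      simp [matJ, smallCell, Matrix.mul_apply, Fin.sum_univ_three] <;> field_simp <;> grind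
  · simp [smallCell, Matrix.det_fin_three]
    field_simp

lemma eq_bigCell {w : Matrix (Fin 3) (Fin 3) F} (h : wᵀ * matJ F * w = matJ F) (hd : w.det = 1)
    (h0 : w 0 0 ≠ 0) : w = bigCell (w 0 0) (-w 0 2 / w 0 0) (w 2 0) := by
  have h3 : (3 : F) = 0 := three_eq_zero_of_charP
  have hadj := matJ_mul_transpose_mul_matJ_eq_adjugate h hd
  have hrow := mul_matJ_mul_transpose h
  rw [Matrix.adjugate_fin_three] at hadj
  have e1 := congrFun₂ h 0 0
  have e2 := congrFun₂ hrow 0 0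
  have e3 := congrFun₂ hadj 1 2
  have e4 := congrFun₂ hadj 2 1
  have e5 := congrFun₂ hadj 2 2
  have e6 := congrFun₂ hadj 1 1
  simp [matJ, Matrix.mul_apply, Matrix.vecMul, dotProduct, Fin.sum_univ_three] at e1 e2 e3 e4 e5 e6
  clear h hd hadj hrow
  have d10 : w 1 0 = w 2 0 ^ 2 / w 0 0 := by field_simp; grind
  have d01 : w 0 1 = w 0 2 ^ 2 / w 0 0 := by field_simp; grind
  have d22 : w 2 2 = (w 0 0 + w 0 2 * w 2 0) / w 0 0 := by field_simp; grind
  have d12 : w 1 2 = (w 0 2 * w 1 0 - w 2 0) / w 0 0 := by field_simp; grind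
  have d21 : w 2 1 = (w 0 1 * w 2 0 - w 0 2) / w 0 0 := by field_simp; grind
  have d11 : w 1 1 = (w 2 2 + w 0 1 * w 1 0) / w 0 0 := by field_simp; grind
  rw [d10] at d12 d11
  rw [d01] at d21 d11
  rw [d22] at d11
  ext i j
  fin_cases i <;> fin_cases j <;> simp [bigCell]
  · rw [d01]; field_simp
  · field_simp
  · exact d10
  · rw [d11]; field_simp; grind
  · rw [d12]; field_simp; grind
  · rw [d21]; field_simp; grind
  · rw [d22]; field_simp; grind

lemma eq_smallCell {w : Matrix (Fin 3) (Fin 3) F} (h : wᵀ * matJ F * w = matJ F) (hd : w.det = 1)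
    (h0 : w 0 0 = 0) : w 1 0 ≠ 0 ∧ w = smallCell (w 1 0) (w 1 2) := by
  have h3 : (3 : F) = 0 := three_eq_zero_of_charP
  have hadj := matJ_mul_transpose_mul_matJ_eq_adjugate h hd
  have hrow := mul_matJ_mul_transpose h
  rw [Matrix.adjugate_fin_three] at hadj
  have e1 := congrFun₂ h 0 0
  have e2 := congrFun₂ hrow 0 0
  have e3 := congrFun₂ h 0 1
  have e4 := congrFun₂ h 1 1
  have e5 := congrFun₂ h 1 2
  have e6 := congrFun₂ hadj 2 2
  simp [matJ, Matrix.mul_apply, Matrix.vecMul, dotProduct, Fin.sum_univ_three, h0] at e1 e2 e3 e4 e5 e6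
  simp only [e1, e2, zero_mul, mul_zero, add_zero, zero_add] at e3 e4 e5 e6
  have hne : w 1 0 ≠ 0 := left_ne_zero_of_mul_eq_one e3
  have d22 : w 2 2 = -1 := by grind
  have d01 : w 0 1 = 1 / w 1 0 := by field_simp; grind
  have d21 : w 2 1 = w 1 2 / w 1 0 := by
    rw [d22, d01] at e5; field_simp at e5 ⊢; grind
  have d11 : w 1 1 = w 1 2 ^ 2 / w 1 0 := by
    rw [d21, d01] at e4; field_simp at e4 ⊢; grind
  refine ⟨hne, ?_⟩
  ext i j
  fin_cases i <;> fin_cases j <;> simp [smallCell, *]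

lemma trace_bigCell_eq_iff {p : F} (hp : p ≠ 0) (x r β : F) :
    (bigCell p x r).trace = β ↔ (p + 1 + x * r) ^ 2 = (β + 1) * p := by
  have h3 : (3 : F) = 0 := three_eq_zero_of_charP
  simp only [bigCell, Matrix.trace_fin_three]
  simp
  field_simp
  constructor <;> intro h <;> grind

lemma trace_smallCell_eq_iff {p : F} (hp : p ≠ 0) (k β : F) :
    (smallCell p k).trace = β ↔ k ^ 2 = (β + 1) * p := by
  simp only [smallCell, Matrix.trace_fin_three]
  simp
  field_simp
  constructor <;> intro h <;> grind

end CharThree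

section Counting

variable {F : Type} [Field F] [Fintype F] [DecidableEq F]

lemma card_filter_mul_eq (m : F) :
    #{y : F × F | y.1 * y.2 = m} = (Fintype.card F - 1) + if m = 0 then Fintype.card F else 0 := by
  have fiber (x : F) : #{r : F | x * r = m} =
      if x = 0 then (if m = 0 then Fintype.card F else 0) else 1 := by
    split_ifs with hx hm
    · simp [hx, hm]
    · simp [hx, Ne.symm hm]
    · rw [Finset.card_eq_one]
      exact ⟨m / x, by ext r; simp [eq_div_iff hx, mul_comm]⟩
  have hcard : #{y : F × F | y.1 * y.2 = m} = ∑ x : F, #{r : F | x * r = m} := by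
    simp only [Finset.card_filter, Fintype.sum_prod_type]
  rw [hcard, Finset.sum_congr rfl fun x _ => fiber x, Finset.sum_ite]
  simp [Finset.filter_ne', Finset.filter_eq', add_comm]

lemma card_filter_sq_eq_mul (c : F) :
    #{y : F × F | y.1 ≠ 0 ∧ y.2 ^ 2 = c * y.1} = Fintype.card F - 1 := by
  rw [← Finset.card_univ, ← Finset.card_erase_of_mem (Finset.mem_univ (0 : F))]
  by_cases hc : c = 0
  · refine Finset.card_nbij' (fun y => y.1) (fun p => (p, 0)) ?_ ?_ ?_ ?_ <;> intro y <;>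
      simp [hc, Prod.ext_iff] <;> tauto
  · refine Finset.card_nbij' (fun y => y.2) (fun k => (k ^ 2 / c, k)) ?_ ?_ ?_ ?_ <;> intro y <;>
      simp [hc, Prod.ext_iff, div_eq_iff, mul_comm, mul_div_cancel₀]
    · intro h h' h2
      simp_all

lemma card_filter_bigCell (β : F) (h3 : (3 : F) = 0) :
    #{z : F × F × F | z.1 ≠ 0 ∧ (z.1 + 1 + z.2.1 * z.2.2) ^ 2 = (β + 1) * z.1} =
      (Fintype.card F - 1) * (Fintype.card F - 1) + Fintype.card F * delta1 F (β - 1) := by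
  set T : Finset (F × F) := {y : F × F | y.1 ≠ 0 ∧ y.2 ^ 2 = (β + 1) * y.1} with hT
  have hfib : ∀ y ∈ T, #{z ∈ ({z : F × F × F | z.1 ≠ 0 ∧
      (z.1 + 1 + z.2.1 * z.2.2) ^ 2 = (β + 1) * z.1} : Finset _) |
      (z.1, z.1 + 1 + z.2.1 * z.2.2) = y} =
      (Fintype.card F - 1) + if y.2 - y.1 - 1 = 0 then Fintype.card F else 0 := by
    rintro ⟨p, k⟩ hy
    rw [← card_filter_mul_eq]
    simp only [hT, Finset.mem_filter, Finset.mem_univ, true_and] at hy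
    refine Finset.card_nbij' (fun z => z.2) (fun y => (p, y)) ?_ ?_ ?_ ?_
    · intro z
      simp [Prod.ext_iff]
      grind
    · intro z
      simp [Prod.ext_iff]
      grind
    · intro z
      simp [Prod.ext_iff]
      grind
    · intro z
      simp
  have hδ : #{y ∈ T | y.2 - y.1 - 1 = 0} = delta1 F (β - 1) := by
    refine Finset.card_nbij' (fun y => y.1) (fun p => (p, p + 1)) ?_ ?_ ?_ ?_ <;> intro y <;>
      simp [hT, Prod.ext_iff] <;> grind
  rw [Finset.card_eq_sum_card_fiberwise (t := T)
    (f := fun z : F × F × F => (z.1, z.1 + 1 + z.2.1 * z.2.2)) (by intro z; simp [hT]),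
    Finset.sum_congr rfl hfib, Finset.sum_add_distrib, Finset.sum_ite, Finset.sum_const,
    Finset.sum_const, hδ, hT, card_filter_sq_eq_mul]
  simp [mul_comm]

end Counting

/-- The number of w ∈ SO(3,q) with Tr w = β equals `q² - q + q·δ(1,q;β-1)`, where q = 3^r. -/
theorem SO3_trace_fiber_count (r : ℕ) (hr : 0 < r) (F : Type) [Field F] [Fintype F]
    [DecidableEq F] (hF : Fintype.card F = 3 ^ r) (β : F) :
    (Finset.univ.filter
      (fun w : Matrix (Fin 3) (Fin 3) F =>
        w.det ≠ 0 ∧ wᵀ * matJ F * w = matJ F ∧ w.det = 1 ∧ w.trace = β)).card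
      = 3 ^ r * 3 ^ r - 3 ^ r + 3 ^ r * delta1 F (β - 1) := by
  have : CharP F 3 := by
    have : Fact (Nat.Prime 3) := ⟨Nat.prime_three⟩
    exact charP_of_card_eq_prime_pow hF
  have hsmall : #{w : Matrix (Fin 3) (Fin 3) F | (w.det ≠ 0 ∧ wᵀ * matJ F * w = matJ F ∧
      w.det = 1 ∧ w.trace = β) ∧ w 0 0 = 0} =
      #{y : F × F | y.1 ≠ 0 ∧ y.2 ^ 2 = (β + 1) * y.1} := by
    refine Finset.card_nbij' (fun w => (w 1 0, w 1 2)) (fun y => smallCell y.1 y.2) ?_ ?_ ?_ ?_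
    · intro w hw
      obtain ⟨⟨-, h, hd, ht⟩, h0⟩ := by simpa using hw
      obtain ⟨hne, he⟩ := eq_smallCell h hd h0
      rw [he, trace_smallCell_eq_iff hne] at ht
      simpa using ⟨hne, ht⟩
    · intro y hy
      obtain ⟨hne, hk⟩ := by simpa using hy
      have hm := smallCell_mem hne y.2
      simpa [hm, trace_smallCell_eq_iff hne] using ⟨hk, by simp [smallCell]⟩
    · intro w hw
      obtain ⟨⟨-, h, hd, ht⟩, h0⟩ := by simpa using hw
      exact (eq_smallCell h hd h0).2.symm
    · intro y _
      simp [smallCell]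
  have hbig : #{w : Matrix (Fin 3) (Fin 3) F | (w.det ≠ 0 ∧ wᵀ * matJ F * w = matJ F ∧
      w.det = 1 ∧ w.trace = β) ∧ ¬ w 0 0 = 0} =
      #{z : F × F × F | z.1 ≠ 0 ∧ (z.1 + 1 + z.2.1 * z.2.2) ^ 2 = (β + 1) * z.1} := by
    refine Finset.card_nbij' (fun w => (w 0 0, -w 0 2 / w 0 0, w 2 0))
      (fun z => bigCell z.1 z.2.1 z.2.2) ?_ ?_ ?_ ?_
    · intro w hw
      obtain ⟨⟨-, h, hd, ht⟩, h0⟩ := by simpa using hw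
      rw [eq_bigCell h hd h0, trace_bigCell_eq_iff h0] at ht
      simpa using ⟨h0, ht⟩
    · intro z hz
      obtain ⟨hne, hk⟩ := by simpa using hz
      have hm := bigCell_mem hne z.2.1 z.2.2
      simpa [hm, trace_bigCell_eq_iff hne] using ⟨hk, by simpa [bigCell] using hne⟩
    · intro w hw
      obtain ⟨⟨-, h, hd, ht⟩, h0⟩ := by simpa using hw
      exact (eq_bigCell h hd h0).symm
    · intro z hz
      obtain ⟨hne, -⟩ := by simpa using hz
      simp [bigCell, hne]
  rw [← Finset.card_filter_add_card_filter_not (fun w : Matrix (Fin 3) (Fin 3) F => w 0 0 = 0),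
    Finset.filter_filter, Finset.filter_filter, hsmall, hbig, card_filter_sq_eq_mul,
    card_filter_bigCell β three_eq_zero_of_charP, ← hF]
  obtain ⟨n, hn⟩ : ∃ n, Fintype.card F = n + 1 := Nat.exists_eq_succ_of_ne_zero Fintype.card_ne_zero
  have hsub : (n + 1) * (n + 1) - (n + 1) = n + n * n := by
    rw [Nat.sub_eq_iff_eq_add (by nlinarith)]
    ring
  rw [hn, hsub, Nat.add_sub_cancel]
  ring
end

section
/- For every β ∈ F_q, the number of matrices w ∈ O(3,q) with Tr(w) = β equals 2q² - 2q + q·δ(1,q;β-1) + q·δ(1,q;β+1), where Tr denotes the matrix trace. -/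
open Finset Matrix

/-- A finite field with `3 ^ r` elements has characteristic three. -/
lemma three_eq_zero_of_card {r : ℕ} {F : Type} [Field F] [Fintype F]
    (hF : Fintype.card F = 3 ^ r) : (3 : F) = 0 := by
  have h : ((Fintype.card F : ℕ) : F) = 0 := FiniteField.cast_card_eq_zero F
  rw [hF, Nat.cast_pow] at h
  exact_mod_cast eq_zero_of_pow_eq_zero h

lemma matJ_isometry_iff {F : Type} [Field F] (w : Matrix (Fin 3) (Fin 3) F) :
    wᵀ * matJ F * w = matJ F ↔
      2 * w 0 0 * w 1 0 + w 2 0 ^ 2 = 0 ∧ 2 * w 0 1 * w 1 1 + w 2 1 ^ 2 = 0 ∧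
      2 * w 0 2 * w 1 2 + w 2 2 ^ 2 = 1 ∧
      w 0 0 * w 1 1 + w 1 0 * w 0 1 + w 2 0 * w 2 1 = 1 ∧
      w 0 0 * w 1 2 + w 1 0 * w 0 2 + w 2 0 * w 2 2 = 0 ∧
      w 0 1 * w 1 2 + w 1 1 * w 0 2 + w 2 1 * w 2 2 = 0 := by
  rw [← Matrix.ext_iff]
  simp only [Fin.forall_fin_succ, Matrix.mul_apply, Fin.sum_univ_three, matJ]
  simp
  constructor
  · rintro ⟨⟨h1, h2, h3⟩, ⟨-, h4, h5⟩, -, -, h6⟩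
    exact ⟨by linear_combination h1, by linear_combination h4, by linear_combination h6,
      by linear_combination h2, by linear_combination h3, by linear_combination h5⟩
  · rintro ⟨h1, h2, h3, h4, h5, h6⟩
    refine ⟨⟨?_, ?_, ?_⟩, ⟨?_, ?_, ?_⟩, ?_, ?_, ?_⟩
    · linear_combination h1
    · linear_combination h4
    · linear_combination h5
    · linear_combination h4
    · linear_combination h2
    · linear_combination h6
    · linear_combination h5
    · linear_combination h6
    · linear_combination h3

lemma matJ_isometry_transpose {F : Type} [Field F] {w : Matrix (Fin 3) (Fin 3) F}
    (h : wᵀ * matJ F * w = matJ F) : wᵀᵀ * matJ F * wᵀ = matJ F := by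
  have h1 : (matJ F * wᵀ * matJ F) * w = 1 := by
    rw [Matrix.mul_assoc (matJ F), Matrix.mul_assoc, h, matJ_mul_self]
  have h2 : w * (matJ F * wᵀ * matJ F) = 1 := mul_eq_one_comm.mp h1
  rw [transpose_transpose]
  calc w * matJ F * wᵀ = w * (matJ F * wᵀ * matJ F) * matJ F := by
        simp only [Matrix.mul_assoc, matJ_mul_self, Matrix.mul_one]
    _ = matJ F := by rw [h2, Matrix.one_mul]

lemma det_ne_zero_of_matJ_isometry {F : Type} [Field F] {w : Matrix (Fin 3) (Fin 3) F}
    (h : wᵀ * matJ F * w = matJ F) : w.det ≠ 0 := by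
  intro h0
  have h1 := congrArg Matrix.det h
  rw [det_mul, h0, mul_zero] at h1
  simp [matJ, det_fin_three] at h1

/-- Elements of the Borel subgroup stabilizing the first coordinate line. -/
def borelMatrix {F : Type} [Field F] (ε a h : F) : Matrix (Fin 3) (Fin 3) F :=
  !![a, a * h ^ 2, -(a * ε * h); 0, a⁻¹, 0; 0, h, ε]

/-- Elements of the big Bruhat cell. -/
def bigCellMatrix {F : Type} [Field F] (ε d x y : F) : Matrix (Fin 3) (Fin 3) F :=
  !![d * x ^ 2, d⁻¹ + d * x ^ 2 * y ^ 2 + ε * x * y, d * x ^ 2 * y - ε * x;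
    d, d * y ^ 2, d * y;
    d * x, d * x * y ^ 2 - ε * y, d * x * y + ε]

section CharThree

variable {F : Type} [Field F]

lemma borelMatrix_isometry (h3 : (3 : F) = 0) {ε a h : F} (hε : ε ^ 2 = 1) (ha : a ≠ 0) :
    (borelMatrix ε a h)ᵀ * matJ F * borelMatrix ε a h = matJ F := by
  rw [matJ_isometry_iff]
  simp [borelMatrix]
  grind

lemma bigCellMatrix_isometry (h3 : (3 : F) = 0) {ε d x y : F} (hε : ε ^ 2 = 1) (hd : d ≠ 0) :
    (bigCellMatrix ε d x y)ᵀ * matJ F * bigCellMatrix ε d x y = matJ F := by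
  rw [matJ_isometry_iff]
  simp [bigCellMatrix]
  refine ⟨?_, ?_, ?_, ?_, ?_, ?_⟩ <;> grind

lemma eq_borelMatrix (h3 : (3 : F) = 0) {w : Matrix (Fin 3) (Fin 3) F}
    (hw : wᵀ * matJ F * w = matJ F) (h0 : w 1 0 = 0) :
    w 2 2 ^ 2 = 1 ∧ w 0 0 ≠ 0 ∧ w = borelMatrix (w 2 2) (w 0 0) (w 2 1) := by
  rw [matJ_isometry_iff] at hw
  obtain ⟨h1, h2, h4, h5, h6, h7⟩ := hw
  have h20 : w 2 0 = 0 := by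
    apply eq_zero_of_pow_eq_zero (n := 2)
    simpa [h0] using h1
  simp only [h0, h20, zero_mul, add_zero] at h5 h6
  have ha : w 0 0 ≠ 0 := by
    intro h; simp [h] at h5
  have h12 : w 1 2 = 0 := by simpa [ha] using h6
  simp only [h12, mul_zero, zero_add] at h4 h7
  refine ⟨h4, ha, ?_⟩
  rw [← Matrix.ext_iff]
  simp [Fin.forall_fin_succ, borelMatrix, h0, h20, h12]
  refine ⟨⟨?_, ?_⟩, ?_⟩ <;> grind

lemma eq_bigCellMatrix (h3 : (3 : F) = 0) {w : Matrix (Fin 3) (Fin 3) F}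
    (hw : wᵀ * matJ F * w = matJ F) (h0 : w 1 0 ≠ 0) :
    (w 2 2 - w 2 0 * w 1 2 / w 1 0) ^ 2 = 1 ∧
      w = bigCellMatrix (w 2 2 - w 2 0 * w 1 2 / w 1 0) (w 1 0) (w 2 0 / w 1 0)
        (w 1 2 / w 1 0) := by
  have hw' := matJ_isometry_transpose hw
  rw [matJ_isometry_iff] at hw hw'
  simp only [transpose_apply] at hw'
  obtain ⟨h1, h2, h4, h5, h6, h7⟩ := hw
  obtain ⟨k1, k2, k4, k5, k6, k7⟩ := hw'
  obtain ⟨x, hx⟩ : ∃ x, x = w 2 0 / w 1 0 := ⟨_, rfl⟩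
  obtain ⟨y, hy⟩ : ∃ y, y = w 1 2 / w 1 0 := ⟨_, rfl⟩
  obtain ⟨ε, hε⟩ : ∃ ε, ε = w 2 2 - w 2 0 * w 1 2 / w 1 0 := ⟨_, rfl⟩
  rw [← hx, ← hy, ← hε]
  have e20 : w 2 0 = w 1 0 * x := by rw [hx]; field_simp
  have e12 : w 1 2 = w 1 0 * y := by rw [hy]; field_simp
  have e22 : w 2 2 = w 1 0 * x * y + ε := by rw [hε, hx, hy]; field_simp; ring
  have e00 : w 0 0 = w 1 0 * x ^ 2 := by
    apply mul_left_cancel₀ h0; grind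
  have e11 : w 1 1 = w 1 0 * y ^ 2 := by
    apply mul_left_cancel₀ h0; grind
  have e02 : w 0 2 = w 1 0 * x ^ 2 * y - ε * x := by
    apply mul_left_cancel₀ h0; grind
  have e21 : w 2 1 = w 1 0 * x * y ^ 2 - ε * y := by
    apply mul_left_cancel₀ h0; grind
  have e01 : w 0 1 = (w 1 0)⁻¹ + w 1 0 * x ^ 2 * y ^ 2 + ε * x * y := by
    apply mul_left_cancel₀ h0
    rw [mul_add, mul_add, mul_inv_cancel₀ h0]; grind
  refine ⟨by grind, ?_⟩
  rw [← Matrix.ext_iff]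
  simp [Fin.forall_fin_succ, bigCellMatrix, e20, e12, e22, e00, e11, e02, e21, e01]

variable [Fintype F] [DecidableEq F]

lemma card_borel_fiber (h3 : (3 : F) = 0) {ε : F} (hε : ε ^ 2 = 1) (β : F) :
    (univ.filter (fun w : Matrix (Fin 3) (Fin 3) F =>
      (wᵀ * matJ F * w = matJ F ∧ w.trace = β) ∧ w 1 0 = 0 ∧ w 2 2 = ε)).card
      = Fintype.card F * delta1 F (β - ε) := by
  rw [delta1, ← card_univ, ← card_product]
  refine card_nbij' (fun w => (w 2 1, w 0 0)) (fun p => borelMatrix ε p.2 p.1) ?_ ?_ ?_ ?_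
  · intro w hw
    simp only [coe_filter, Set.mem_ofPred_eq, mem_univ, true_and] at hw
    obtain ⟨⟨hw, ht⟩, h0, he⟩ := hw
    obtain ⟨-, ha, h⟩ := eq_borelMatrix h3 hw h0
    rw [h, trace_fin_three, he] at ht
    simp [borelMatrix] at ht
    simp
    rw [← ht]
    field_simp
    ring
  · rintro ⟨h, a⟩ hp
    simp at hp
    have ha : a ≠ 0 := by rintro rfl; simp at hp
    simp only [coe_filter, Set.mem_ofPred_eq, mem_univ, true_and]
    refine ⟨⟨borelMatrix_isometry h3 hε ha, ?_⟩, ?_, ?_⟩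
    · rw [trace_fin_three]
      simp [borelMatrix]
      field_simp
      linear_combination hp
    · simp [borelMatrix]
    · simp [borelMatrix]
  · intro w hw
    simp only [coe_filter, Set.mem_ofPred_eq, mem_univ, true_and] at hw
    obtain ⟨⟨hw, ht⟩, h0, he⟩ := hw
    obtain ⟨-, ha, h⟩ := eq_borelMatrix h3 hw h0
    rw [he] at h
    exact h.symm
  · rintro ⟨h, a⟩ hp
    simp [borelMatrix]

/-- The curve `d z² = c` has `q - 1` points with `d ≠ 0`. -/
lemma card_mul_sq_eq (c : F) :
    (univ.filter (fun p : F × F => p.1 ≠ 0 ∧ p.1 * p.2 ^ 2 = c)).card = Fintype.card F - 1 := by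
  rw [← card_univ, ← card_erase_of_mem (mem_univ (0 : F))]
  by_cases hc : c = 0
  · refine card_nbij' (fun p => p.1) (fun d => (d, 0)) ?_ ?_ ?_ ?_
    · intro p hp
      simp_all
    · intro d hd
      simp_all
    · rintro ⟨d, z⟩ hp
      simp [hc] at hp
      simp [hp.2.resolve_left hp.1]
    · intro d hd
      rfl
  · refine card_nbij' (fun p => p.2) (fun z => (c / z ^ 2, z)) ?_ ?_ ?_ ?_
    · rintro ⟨d, z⟩ hp
      simp at hp ⊢
      rintro rfl
      simp at hp
      exact hc hp.2.symm
    · intro z hz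
      simp at hz ⊢
      exact ⟨⟨hc, hz⟩, by field_simp⟩
    · rintro ⟨d, z⟩ hp
      simp at hp ⊢
      have hz : z ≠ 0 := by
        rintro rfl
        simp at hp
        exact hc hp.2.symm
      rw [← hp.2]
      field_simp
    · intro z hz
      rfl

lemma card_bigCell_fiber (h3 : (3 : F) = 0) {ε : F} (hε : ε ^ 2 = 1) (β : F) :
    (univ.filter (fun w : Matrix (Fin 3) (Fin 3) F =>
      (wᵀ * matJ F * w = matJ F ∧ w.trace = β) ∧
        w 1 0 ≠ 0 ∧ w 2 2 - w 2 0 * w 1 2 / w 1 0 = ε)).card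
      = Fintype.card F * (Fintype.card F - 1) := by
  rw [← card_mul_sq_eq (β - ε), ← card_univ, ← card_product]
  refine card_nbij' (fun w => (w 2 0 / w 1 0, (w 1 0, w 2 0 / w 1 0 - w 1 2 / w 1 0)))
    (fun p => bigCellMatrix ε p.2.1 p.1 (p.1 - p.2.2)) ?_ ?_ ?_ ?_
  · intro w hw
    simp only [coe_filter, Set.mem_ofPred_eq, mem_univ, true_and] at hw
    obtain ⟨⟨hw, ht⟩, h0, he⟩ := hw
    obtain ⟨-, h⟩ := eq_bigCellMatrix h3 hw h0
    rw [he] at h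
    rw [h, trace_fin_three] at ht
    simp only [coe_filter, Set.mem_ofPred_eq, coe_product, Set.mem_prod, mem_coe, mem_univ,
      true_and]
    generalize w 2 0 / w 1 0 = x at ht ⊢
    generalize w 1 2 / w 1 0 = y at ht ⊢
    simp [bigCellMatrix] at ht
    exact ⟨h0, by linear_combination ht - w 1 0 * x * y * h3⟩
  · rintro ⟨x, d, z⟩ hp
    simp at hp
    obtain ⟨hd, hp⟩ := hp
    simp only [coe_filter, Set.mem_ofPred_eq, mem_univ, true_and]
    refine ⟨⟨bigCellMatrix_isometry h3 hε hd, ?_⟩, ?_, ?_⟩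
    · rw [trace_fin_three]
      simp [bigCellMatrix]
      linear_combination hp + (d * x ^ 2 - d * x * z) * h3
    · simpa [bigCellMatrix] using hd
    · simp [bigCellMatrix]
      field_simp
      ring
  · intro w hw
    simp only [coe_filter, Set.mem_ofPred_eq, mem_univ, true_and] at hw
    obtain ⟨⟨hw, ht⟩, h0, he⟩ := hw
    obtain ⟨-, h⟩ := eq_bigCellMatrix h3 hw h0
    rw [he] at h
    simp only [sub_sub_cancel]
    exact h.symm
  · rintro ⟨x, d, z⟩ hp
    simp at hp
    obtain ⟨hd, hp⟩ := hp
    simp [bigCellMatrix, hd]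

end CharThree

/-- The number of w ∈ O(3,q) with Tr w = β equals
`2q² - 2q + q·δ(1,q;β-1) + q·δ(1,q;β+1)`, where q = 3^r. -/
theorem O3_trace_fiber_count (r : ℕ) (hr : 0 < r) (F : Type) [Field F] [Fintype F]
    [DecidableEq F] (hF : Fintype.card F = 3 ^ r) (β : F) :
    (Finset.univ.filter
      (fun w : Matrix (Fin 3) (Fin 3) F =>
        w.det ≠ 0 ∧ wᵀ * matJ F * w = matJ F ∧ w.trace = β)).card
      = 2 * (3 ^ r) * 3 ^ r - 2 * 3 ^ r + 3 ^ r * delta1 F (β - 1)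
        + 3 ^ r * delta1 F (β + 1) := by
  have h3 : (3 : F) = 0 := three_eq_zero_of_card hF
  have hne : (1 : F) ≠ -1 := by
    intro h
    exact one_ne_zero (α := F) (by linear_combination h3 - h)
  have hneg : (-1 : F) ^ 2 = 1 := by ring
  have hiso (w : Matrix (Fin 3) (Fin 3) F) :
      (w.det ≠ 0 ∧ wᵀ * matJ F * w = matJ F ∧ w.trace = β) ↔
        (wᵀ * matJ F * w = matJ F ∧ w.trace = β) :=
    and_iff_right_of_imp fun h => det_ne_zero_of_matJ_isometry h.1
  have hsplit (P : Matrix (Fin 3) (Fin 3) F → Prop) [DecidablePred P]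
      (f : Matrix (Fin 3) (Fin 3) F → F)
      (hf : ∀ w : Matrix (Fin 3) (Fin 3) F, wᵀ * matJ F * w = matJ F → P w → f w ^ 2 = 1) :
      (univ.filter (fun w : Matrix (Fin 3) (Fin 3) F =>
        (wᵀ * matJ F * w = matJ F ∧ w.trace = β) ∧ P w)).card =
      (univ.filter (fun w : Matrix (Fin 3) (Fin 3) F =>
        (wᵀ * matJ F * w = matJ F ∧ w.trace = β) ∧ P w ∧ f w = 1)).card +
      (univ.filter (fun w : Matrix (Fin 3) (Fin 3) F =>
        (wᵀ * matJ F * w = matJ F ∧ w.trace = β) ∧ P w ∧ f w = -1)).card := by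
    rw [← card_filter_add_card_filter_not (fun w => f w = 1), filter_filter, filter_filter]
    congr 2
    · refine filter_congr fun w _ => ?_
      rw [and_assoc]
    · refine filter_congr fun w _ => ?_
      rw [and_assoc]
      refine and_congr_right fun hw => and_congr_right fun hP => ⟨fun h => ?_, fun h h' => ?_⟩
      · exact (sq_eq_one_iff.mp (hf w hw.1 hP)).resolve_left h
      · exact hne (h'.symm.trans h)
  rw [filter_congr fun w _ => hiso w,
    ← card_filter_add_card_filter_not (fun w : Matrix (Fin 3) (Fin 3) F => w 1 0 = 0),
    filter_filter, filter_filter,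
    hsplit (fun w => w 1 0 = 0) (fun w => w 2 2) fun w hw h0 => (eq_borelMatrix h3 hw h0).1,
    hsplit (fun w => ¬ w 1 0 = 0) (fun w => w 2 2 - w 2 0 * w 1 2 / w 1 0)
      fun w hw h0 => (eq_bigCellMatrix h3 hw h0).1,
    card_borel_fiber h3 (one_pow 2), card_borel_fiber h3 hneg,
    card_bigCell_fiber h3 (one_pow 2), card_bigCell_fiber h3 hneg, sub_neg_eq_add, hF]
  obtain ⟨n, hn⟩ : ∃ n, 3 ^ r = n + 1 := Nat.exists_eq_succ_of_ne_zero (by positivity)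
  rw [hn, Nat.add_sub_cancel]
  have : 2 * (n + 1) * (n + 1) - 2 * (n + 1) = 2 * ((n + 1) * n) := by
    rw [Nat.sub_eq_iff_eq_add (by nlinarith)]; ring
  rw [this]
  ring
end
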